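/- arXiv:1703.06608 — 2 statements merged into one kernel-verified Lean document; each statement's English description precedes it below -/
import Mathlib

section
/- For all real numbers a, b > 0 with a ≠ b, one has A + G − P < X < A + G − (π(e−1)/(2e))·P, where e is Euler's number; that is, A + G − α₁·P < X < A + G − β₁·P holds with α₁ = 1 and β₁ = π(e−1)/(2e). -/
open Real

/-- Arithmetic mean -/
noncomputable def Am (a b : ℝ) : ℝ := (a + b) / 2

/-- Geometric mean -/
noncomputable def Gm (a b : ℝ) : ℝ := Real.sqrt (a * b)

/-- Harmonic mean -/
noncomputable def Hm (a b : ℝ) : ℝ := 2 * a * b / (a + b)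

/-- Seiffert mean -/
noncomputable def Pm (a b : ℝ) : ℝ := (a - b) / (2 * Real.arcsin ((a - b) / (a + b)))

/-- Sándor's X mean -/
noncomputable def Xm (a b : ℝ) : ℝ := Am a b * Real.exp (Gm a b / Pm a b - 1)

/-- Logarithmic mean -/
noncomputable def Lm (a b : ℝ) : ℝ := (a - b) / (Real.log a - Real.log b)

/-- Identric mean -/
noncomputable def Im (a b : ℝ) : ℝ := (1 / Real.exp 1) * ((a ^ a) / (b ^ b)) ^ (1 / (a - b))

/-- Power mean -/
noncomputable def Mp (p a b : ℝ) : ℝ :=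
  if p = 0 then Real.sqrt (a * b) else ((a ^ p + b ^ p) / 2) ^ (1 / p)

/-- Power-type Heronian mean -/
noncomputable def Hp (p a b : ℝ) : ℝ :=
  if p = 0 then Real.sqrt (a * b) else ((a ^ p + (a * b) ^ (p / 2) + b ^ p) / 3) ^ (1 / p)

open Set

lemma mul_cos_lt_sin {x : ℝ} (h0 : 0 < x) (h1 : x < π / 2) : x * cos x < sin x := by
  have hc : 0 < cos x := cos_pos_of_mem_Ioo ⟨by linarith, h1⟩
  have h := lt_tan h0 h1
  rwa [tan_eq_sin_div_cos, lt_div_iff₀ hc] at h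

/-- Cusa's inequality. -/
lemma three_mul_sin_lt {x : ℝ} (h0 : 0 < x) (h1 : x ≤ π) : 3 * sin x < x * (2 + cos x) := by
  have hmono : StrictMonoOn (fun y ↦ y * (2 + cos y) - 3 * sin y) (Icc 0 π) := by
    refine strictMonoOn_of_hasDerivWithinAt_pos (convex_Icc _ _) (by fun_prop)
      (f' := fun y ↦ 2 - 2 * cos y - y * sin y) (fun y _ ↦ ?_) fun y hy ↦ ?_
    · refine (HasDerivAt.congr_deriv (((hasDerivAt_id y).mul ((hasDerivAt_cos y).const_add 2)).sub
        ((hasDerivAt_sin y).const_mul 3)) ?_).hasDerivWithinAt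
      simp only [id]
      ring
    · rw [interior_Icc] at hy
      have hs : 0 < sin (y / 2) :=
        sin_pos_of_pos_of_lt_pi (by linarith [hy.1]) (by linarith [hy.1, hy.2])
      have h := mul_cos_lt_sin (x := y / 2) (by linarith [hy.1]) (by linarith [hy.2])
      have e1 : cos y = 2 * cos (y / 2) ^ 2 - 1 := by rw [← cos_two_mul]; ring_nf
      have e2 : sin y = 2 * sin (y / 2) * cos (y / 2) := by rw [← sin_two_mul]; ring_nf
      rw [e1, e2]
      nlinarith [sin_sq_add_cos_sq (y / 2), mul_pos hs (sub_pos.2 h)]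
  have h := hmono (left_mem_Icc.2 pi_pos.le) ⟨h0.le, h1⟩ h0
  simp only [sin_zero] at h
  linarith

/-- A Wilker-type inequality. -/
lemma two_mul_sin_sq_lt {x : ℝ} (h0 : 0 < x) (h1 : x ≤ π / 2) :
    2 * sin x ^ 2 < x ^ 2 + x * sin x * cos x := by
  have hmono : StrictMonoOn (fun y ↦ y ^ 2 + y * sin y + 4 * cos y) (Icc 0 π) := by
    refine strictMonoOn_of_hasDerivWithinAt_pos (convex_Icc _ _) (by fun_prop)
      (f' := fun y ↦ y * (2 + cos y) - 3 * sin y) (fun y _ ↦ ?_) fun y hy ↦ ?_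
    · refine (HasDerivAt.congr_deriv (((hasDerivAt_pow 2 y).add
        ((hasDerivAt_id y).mul (hasDerivAt_sin y))).add
        ((hasDerivAt_cos y).const_mul 4)) ?_).hasDerivWithinAt
      simp only [id]
      ring
    · rw [interior_Icc] at hy
      exact sub_pos.2 (three_mul_sin_lt hy.1 hy.2.le)
  have h := hmono (left_mem_Icc.2 pi_pos.le) (⟨by linarith, by linarith⟩ : 2 * x ∈ Icc 0 π)
    (by linarith)
  simp only [sin_zero, cos_zero, sin_two_mul, cos_two_mul] at h
  nlinarith [sin_sq_add_cos_sq x]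

lemma hasDerivAt_sinc {x : ℝ} (hx : x ≠ 0) : HasDerivAt sinc ((cos x - sinc x) / x) x := by
  have h := (hasDerivAt_sin x).div (hasDerivAt_id x) hx
  rw [sinc_of_ne_zero hx]
  refine (h.congr_of_eventuallyEq ?_).congr_deriv ?_
  · filter_upwards [eventually_ne_nhds hx] with y hy
    simp [sinc_of_ne_zero hy]
  · simp only [id]
    field_simp

lemma sinc_pos_of_mem_Icc {x : ℝ} (hx : x ∈ Icc 0 (π / 2)) : 0 < sinc x := by
  rcases hx.1.eq_or_lt with rfl | h0
  · simp
  · rw [sinc_of_ne_zero h0.ne']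
    exact div_pos (sin_pos_of_pos_of_lt_pi h0 (by linarith [hx.2, pi_pos])) h0

lemma cos_nonneg_of_mem_Icc_zero_pi_div_two {x : ℝ} (hx : x ∈ Icc 0 (π / 2)) : 0 ≤ cos x :=
  cos_nonneg_of_mem_Icc ⟨by linarith [hx.1, pi_pos], hx.2⟩

lemma exp_cos_div_sinc_sub_one_lt {x : ℝ} (h0 : 0 < x) (h1 : x ≤ π / 2) :
    exp (cos x / sinc x - 1) < sinc x * (1 + cos x) / (1 + sinc x) := by
  have hmono : StrictMonoOn
      (fun y ↦ log (sinc y) + log (1 + cos y) - log (1 + sinc y) - cos y / sinc y)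
      (Icc 0 (π / 2)) := by
    refine strictMonoOn_of_hasDerivWithinAt_pos (convex_Icc _ _) ?_
      (f' := fun y ↦ (y ^ 2 + y * sin y * cos y - 2 * sin y ^ 2) / (sin y ^ 2 * (y + sin y)))
      (fun y hy ↦ ?_) fun y hy ↦ ?_
    · have hS := continuous_sinc.continuousOn (s := Icc 0 (π / 2))
      have hC := continuous_cos.continuousOn (s := Icc 0 (π / 2))
      refine (((hS.log fun y hy ↦ ?_).add ((continuousOn_const.add hC).log fun y hy ↦ ?_)).sub
        ((continuousOn_const.add hS).log fun y hy ↦ ?_)).sub (hC.div hS fun y hy ↦ ?_)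
      · exact (sinc_pos_of_mem_Icc hy).ne'
      · exact (add_pos_of_pos_of_nonneg one_pos (cos_nonneg_of_mem_Icc_zero_pi_div_two hy)).ne'
      · exact (add_pos one_pos (sinc_pos_of_mem_Icc hy)).ne'
      · exact (sinc_pos_of_mem_Icc hy).ne'
    · rw [interior_Icc] at hy
      have hy0 := hy.1
      have hS := sinc_pos_of_mem_Icc (Ioo_subset_Icc_self hy)
      have hC := cos_nonneg_of_mem_Icc_zero_pi_div_two (Ioo_subset_Icc_self hy)
      have hs : 0 < sin y := sin_pos_of_pos_of_lt_pi hy0 (by linarith [hy.2])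
      have dS := hasDerivAt_sinc hy0.ne'
      have dC := hasDerivAt_cos y
      refine (HasDerivAt.congr_deriv ((((dS.log hS.ne').add
        ((dC.const_add 1).log (by positivity))).sub
        ((dS.const_add 1).log (by positivity))).sub (dC.div dS hS.ne')) ?_).hasDerivWithinAt
      have e : -sin y / (1 + cos y) = -(1 - cos y) / sin y := by
        rw [div_eq_div_iff (by positivity) hs.ne']
        linear_combination -(sin_sq_add_cos_sq y)
      rw [e, sinc_of_ne_zero hy0.ne']
      field_simp
      linear_combination (sin y * y ^ 2 + y ^ 3) * sin_sq_add_cos_sq y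
    · rw [interior_Icc] at hy
      have hy0 := hy.1
      have hs : 0 < sin y := sin_pos_of_pos_of_lt_pi hy0 (by linarith [hy.2])
      have := two_mul_sin_sq_lt hy0 hy.2.le
      exact div_pos (by linarith) (by positivity)
  have hx : x ∈ Icc 0 (π / 2) := ⟨h0.le, h1⟩
  have h := hmono (left_mem_Icc.2 (by positivity)) hx h0
  have hS := sinc_pos_of_mem_Icc hx
  have hC := cos_nonneg_of_mem_Icc_zero_pi_div_two hx
  rw [← lt_log_iff_exp_lt (by positivity), log_div (by positivity) (by positivity),
    log_mul (by positivity) (by positivity)]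
  simp only [sinc_zero, cos_zero, log_one] at h
  linarith

lemma strictAntiOn_one_add_cos_sub_exp_div_sinc :
    StrictAntiOn (fun x ↦ (1 + cos x - exp (cos x / sinc x - 1)) / sinc x) (Icc 0 (π / 2)) := by
  refine strictAntiOn_of_hasDerivWithinAt_neg (convex_Icc _ _) ?_
    (f' := fun y ↦ (1 - sinc y) / (y * sinc y) *
      (exp (cos y / sinc y - 1) * (1 + sinc y) - sinc y * (1 + cos y)) / sinc y ^ 2)
    (fun y hy ↦ ?_) fun y hy ↦ ?_
  · have hS := continuous_sinc.continuousOn (s := Icc 0 (π / 2))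
    have hC := continuous_cos.continuousOn (s := Icc 0 (π / 2))
    have h0 : ∀ y ∈ Icc 0 (π / 2), sinc y ≠ 0 := fun y hy ↦ (sinc_pos_of_mem_Icc hy).ne'
    exact ((continuousOn_const.add hC).sub ((hC.div hS h0).sub continuousOn_const).rexp).div hS h0
  · rw [interior_Icc] at hy
    have hy0 := hy.1
    have hS := sinc_pos_of_mem_Icc (Ioo_subset_Icc_self hy)
    have dS := hasDerivAt_sinc hy0.ne'
    have dC := hasDerivAt_cos y
    refine (HasDerivAt.congr_deriv
      (((dC.const_add 1).sub ((dC.div dS hS.ne').sub_const 1).exp).div dS hS.ne')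
      ?_).hasDerivWithinAt
    have hs : sin y = y * sinc y := by rw [sinc_of_ne_zero hy0.ne']; field_simp
    have hsc := sin_sq_add_cos_sq y
    simp only [Pi.div_apply, Pi.sub_apply]
    rw [hs] at hsc ⊢
    generalize exp (cos y / sinc y - 1) = E
    generalize sinc y = S at *
    generalize cos y = C at *
    field_simp
    linear_combination (E - S) * hsc
  · rw [interior_Icc] at hy
    have hy0 := hy.1
    have hS := sinc_pos_of_mem_Icc (Ioo_subset_Icc_self hy)
    have hS1 : sinc y < 1 := by
      rw [sinc_of_ne_zero hy0.ne', div_lt_one hy0]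
      exact sin_lt hy0
    have h := exp_cos_div_sinc_sub_one_lt hy0 hy.2.le
    rw [lt_div_iff₀ (by positivity)] at h
    exact div_neg_of_neg_of_pos (mul_neg_of_pos_of_neg
      (div_pos (by linarith) (by positivity)) (by linarith)) (by positivity)

lemma one_add_cos_sub_sinc_lt_exp {x : ℝ} (h0 : 0 < x) (h1 : x < π / 2) :
    1 + cos x - sinc x < exp (cos x / sinc x - 1) ∧
    exp (cos x / sinc x - 1) < 1 + cos x - π * (exp 1 - 1) / (2 * exp 1) * sinc x := by
  have hx : x ∈ Icc 0 (π / 2) := ⟨h0.le, h1.le⟩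
  have hS := sinc_pos_of_mem_Icc hx
  have hl := strictAntiOn_one_add_cos_sub_exp_div_sinc (left_mem_Icc.2 (by positivity)) hx h0
  have hr := strictAntiOn_one_add_cos_sub_exp_div_sinc hx (right_mem_Icc.2 (by positivity)) h1
  have e : (1 - exp (-1)) / (π / 2)⁻¹ = π * (exp 1 - 1) / (2 * exp 1) := by
    rw [exp_neg]
    field_simp
  simp only [sinc_zero, cos_zero, div_one, sub_self, exp_zero, add_sub_cancel_right] at hl
  simp only [sinc_of_ne_zero (show π / 2 ≠ 0 by positivity), sin_pi_div_two, cos_pi_div_two,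
    one_div, zero_div, zero_sub, add_zero, e] at hr
  rw [div_lt_one hS] at hl
  rw [lt_div_iff₀ hS] at hr
  constructor <;> linarith

lemma bounds_Xm_of_lt (a b : ℝ) (hb : 0 < b) (hab : b < a) :
    Am a b + Gm a b - Pm a b < Xm a b ∧
    Xm a b < Am a b + Gm a b - (π * (Real.exp 1 - 1) / (2 * Real.exp 1)) * Pm a b := by
  have ha : 0 < a := hb.trans hab
  set x := arcsin ((a - b) / (a + b)) with hx
  have hq0 : 0 < (a - b) / (a + b) := div_pos (by linarith) (by linarith)
  have hq1 : (a - b) / (a + b) < 1 := by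
    rw [div_lt_one (by linarith)]
    linarith
  have h0 : 0 < x := arcsin_pos.2 hq0
  have h1 : x < π / 2 := arcsin_lt_pi_div_two.2 hq1
  have hA : 0 < Am a b := by
    unfold Am
    positivity
  have hsin : sin x = (a - b) / (a + b) := sin_arcsin (by linarith) hq1.le
  have hP : Pm a b = Am a b * sinc x := by
    rw [sinc_of_ne_zero h0.ne', hsin, Pm, ← hx, Am]
    field_simp
  have hG : Gm a b = Am a b * cos x := by
    rw [Gm, hx, cos_arcsin, ← sqrt_sq hA.le, ← sqrt_mul (sq_nonneg _), Am]
    congr 1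
    field_simp
    ring
  have hX : Xm a b = Am a b * exp (cos x / sinc x - 1) := by
    rw [Xm, hP, hG, mul_div_mul_left _ _ hA.ne']
  obtain ⟨hl, hr⟩ := one_add_cos_sub_sinc_lt_exp h0 h1
  rw [hX, hP, hG]
  constructor
  · linarith [mul_lt_mul_of_pos_left hl hA]
  · linarith [mul_lt_mul_of_pos_left hr hA]

theorem stmt_1 (a b : ℝ) (ha : 0 < a) (hb : 0 < b) (hab : a ≠ b) :
    Am a b + Gm a b - Pm a b < Xm a b ∧
    Xm a b < Am a b + Gm a b - (π * (Real.exp 1 - 1) / (2 * Real.exp 1)) * Pm a b := by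
  rcases hab.lt_or_gt with h | h
  · have hA : Am a b = Am b a := by rw [Am, Am, add_comm]
    have hG : Gm a b = Gm b a := by rw [Gm, Gm, mul_comm]
    have hP : Pm a b = Pm b a := by
      rw [Pm, Pm, ← neg_sub b a, add_comm a b, neg_div (b + a), arcsin_neg, mul_neg, neg_div_neg_eq]
    have hX : Xm a b = Xm b a := by rw [Xm, Xm, hA, hG, hP]
    rw [hA, hG, hP, hX]
    exact bounds_Xm_of_lt b a ha h
  · exact bounds_Xm_of_lt a b hb h
end

section
/- For all real numbers a, b > 0 with a ≠ b and every real p ≤ 1/3, one has M_p ≤ M_{1/3} < (2G + A)/3 < X. -/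
open Real

lemma Mp_one_third_eq (a b : ℝ) :
    Mp (1 / 3) a b = ((a ^ (1 / 3 : ℝ) + b ^ (1 / 3 : ℝ)) / 2) ^ 3 := by
  unfold Mp
  rw [if_neg (by norm_num), show (1 / (1 / 3) : ℝ) = ((3 : ℕ) : ℝ) by norm_num, Real.rpow_natCast]

lemma sqrt_mul_rpow_le_mean {a b : ℝ} (ha : 0 < a) (hb : 0 < b) (p : ℝ) :
    √(a * b) ^ p ≤ (a ^ p + b ^ p) / 2 := by
  have hx : 0 < a ^ (p / 2) := rpow_pos_of_pos ha _
  have hy : 0 < b ^ (p / 2) := rpow_pos_of_pos hb _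
  have h (c : ℝ) (hc : 0 < c) : c ^ p = c ^ (p / 2) * c ^ (p / 2) := by
    rw [← rpow_add hc]; ring_nf
  have hg : √(a * b) ^ p = a ^ (p / 2) * b ^ (p / 2) := by
    rw [sqrt_eq_rpow, ← rpow_mul (by positivity), mul_rpow ha.le hb.le]; ring_nf
  rw [hg, h a ha, h b hb]
  nlinarith [sq_nonneg (a ^ (p / 2) - b ^ (p / 2))]

lemma sqrt_mul_le_Mp {a b : ℝ} (ha : 0 < a) (hb : 0 < b) {p : ℝ} (hp : 0 < p) :
    √(a * b) ≤ Mp p a b := by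
  unfold Mp
  rw [if_neg hp.ne']
  have h := rpow_le_rpow (by positivity) (sqrt_mul_rpow_le_mean ha hb p)
    (by positivity : (0 : ℝ) ≤ 1 / p)
  rwa [← rpow_mul (sqrt_nonneg _), mul_one_div_cancel hp.ne', rpow_one] at h

lemma Mp_le_sqrt_mul {a b : ℝ} (ha : 0 < a) (hb : 0 < b) {p : ℝ} (hp : p ≤ 0) :
    Mp p a b ≤ √(a * b) := by
  unfold Mp
  split_ifs with h0
  · exact le_rfl
  · have hpos : 0 < √(a * b) := sqrt_pos.2 (mul_pos ha hb)
    have h := rpow_le_rpow_of_nonpos (rpow_pos_of_pos hpos p) (sqrt_mul_rpow_le_mean ha hb p)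
      (one_div_nonpos.2 hp)
    rwa [← rpow_mul hpos.le, mul_one_div_cancel h0, rpow_one] at h

lemma Mp_le_Mp_of_pos {a b : ℝ} (ha : 0 < a) (hb : 0 < b) {p q : ℝ} (hp : 0 < p) (hpq : p ≤ q) :
    Mp p a b ≤ Mp q a b := by
  have hq : 0 < q := hp.trans_le hpq
  unfold Mp
  rw [if_neg hp.ne', if_neg hq.ne']
  have hap : 0 < a ^ p := rpow_pos_of_pos ha _
  have hbp : 0 < b ^ p := rpow_pos_of_pos hb _
  have hmean : ((a ^ p + b ^ p) / 2) ^ (q / p) ≤ (a ^ q + b ^ q) / 2 := by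
    have h := ((convexOn_rpow ((one_le_div hp).2 hpq)).2 hap.le hbp.le
      (by norm_num : (0 : ℝ) ≤ 1 / 2) (by norm_num : (0 : ℝ) ≤ 1 / 2) (by norm_num))
    simp only [smul_eq_mul, ← rpow_mul ha.le, ← rpow_mul hb.le, mul_div_cancel₀ q hp.ne'] at h
    rw [show (a ^ p + b ^ p) / 2 = 1 / 2 * a ^ p + 1 / 2 * b ^ p by ring]
    linarith
  have h := rpow_le_rpow (by positivity) hmean (by positivity : (0 : ℝ) ≤ 1 / q)
  rwa [← rpow_mul (by positivity), show q / p * (1 / q) = 1 / p by field_simp] at h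

lemma Mp_le_Mp_of_pos_right {a b : ℝ} (ha : 0 < a) (hb : 0 < b) {p q : ℝ} (hq : 0 < q)
    (hpq : p ≤ q) : Mp p a b ≤ Mp q a b := by
  rcases le_or_gt p 0 with hp | hp
  · exact (Mp_le_sqrt_mul ha hb hp).trans (sqrt_mul_le_Mp ha hb hq)
  · exact Mp_le_Mp_of_pos ha hb hp hpq

lemma Mp_one_third_lt {a b : ℝ} (ha : 0 < a) (hb : 0 < b) (hab : a ≠ b) :
    Mp (1 / 3) a b < (2 * Gm a b + Am a b) / 3 := by
  obtain ⟨x, hx, rfl⟩ : ∃ x : ℝ, 0 < x ∧ x ^ 6 = a :=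
    ⟨a ^ ((6 : ℕ) : ℝ)⁻¹, rpow_pos_of_pos ha _, rpow_inv_natCast_pow ha.le (by norm_num)⟩
  obtain ⟨y, hy, rfl⟩ : ∃ y : ℝ, 0 < y ∧ y ^ 6 = b :=
    ⟨b ^ ((6 : ℕ) : ℝ)⁻¹, rpow_pos_of_pos hb _, rpow_inv_natCast_pow hb.le (by norm_num)⟩
  have hcbrt (z : ℝ) (hz : 0 < z) : (z ^ 6) ^ (1 / 3 : ℝ) = z ^ 2 := by
    rw [← rpow_natCast z 6, ← rpow_mul hz.le, ← rpow_natCast z 2]; norm_num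
  have hG : Gm (x ^ 6) (y ^ 6) = x ^ 3 * y ^ 3 := by
    unfold Gm
    rw [show x ^ 6 * y ^ 6 = (x ^ 3 * y ^ 3) ^ 2 by ring, sqrt_sq (by positivity)]
  have hxy : x - y ≠ 0 := fun h => hab (by rw [sub_eq_zero.1 h])
  have hpos : 0 < (x - y) ^ 4 * (x ^ 2 + y ^ 2 + 4 * (x * y)) := by positivity
  rw [Mp_one_third_eq, hcbrt x hx, hcbrt y hy, hG, Am]
  nlinarith [hpos]

lemma lt_sin_mul_cos_add_two_div {t : ℝ} (h0 : 0 < t) (h1 : t < π / 2) :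
    t < sin t * (cos t + 2) / (1 + 2 * cos t) := by
  have hcos : ∀ x ∈ Set.Icc 0 t, 0 < cos x := fun x hx =>
    cos_pos_of_mem_Ioo ⟨by linarith [hx.1, pi_pos], by linarith [hx.2]⟩
  have hd : ∀ x ∈ Set.Icc 0 t, HasDerivAt
      (fun x => sin x * (cos x + 2) / (1 + 2 * cos x) - x)
      (2 * (1 - cos x) ^ 2 * (1 + cos x) / (1 + 2 * cos x) ^ 2) x := by
    intro x hx
    have hc := hcos x hx
    have hne : 1 + 2 * cos x ≠ 0 := by positivity
    refine ((((hasDerivAt_sin x).mul ((hasDerivAt_cos x).add_const 2)).div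
      (((hasDerivAt_cos x).const_mul 2).const_add 1) hne).sub (hasDerivAt_id x)).congr_deriv ?_
    simp only [Pi.mul_apply]
    field_simp
    linear_combination 3 * sin_sq_add_cos_sq x
  have hmono : StrictMonoOn (fun x => sin x * (cos x + 2) / (1 + 2 * cos x) - x)
      (Set.Icc 0 t) := by
    apply strictMonoOn_of_deriv_pos (convex_Icc 0 t)
      (fun x hx => (hd x hx).continuousAt.continuousWithinAt)
    intro x hx
    rw [interior_Icc] at hx
    rw [(hd x (Set.Ioo_subset_Icc_self hx)).deriv]
    have hc := hcos x (Set.Ioo_subset_Icc_self hx)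
    have hlt : cos x < 1 := by
      simpa using cos_lt_cos_of_nonneg_of_le_pi_div_two le_rfl (by linarith [hx.2]) hx.1
    have : 0 < 1 - cos x := by linarith
    positivity
  have h := hmono (Set.left_mem_Icc.2 h0.le) (Set.right_mem_Icc.2 h0.le) h0
  simpa using h

lemma log_one_add_two_cos_lt {t : ℝ} (h0 : 0 < t) (h1 : t < π / 2) :
    log ((1 + 2 * cos t) / 3) < t * cos t / sin t - 1 := by
  have hcos : ∀ x ∈ Set.Icc 0 t, 0 < cos x := fun x hx =>
    cos_pos_of_mem_Ioo ⟨by linarith [hx.1, pi_pos], by linarith [hx.2]⟩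
  have hsin : ∀ x ∈ Set.Ioc 0 t, 0 < sin x := fun x hx =>
    sin_pos_of_pos_of_lt_pi hx.1 (by linarith [hx.2, pi_pos])
  have hsinc : ∀ x ∈ Set.Icc 0 t, sinc x ≠ 0 := by
    intro x hx
    rcases hx.1.eq_or_lt with rfl | hx0
    · simp
    · rw [sinc_of_ne_zero hx0.ne']
      exact (div_pos (hsin x ⟨hx0, hx.2⟩) hx0).ne'
  have hmono : StrictMonoOn (fun x => cos x / sinc x - 1 - log ((1 + 2 * cos x) / 3))
      (Set.Icc 0 t) := by
    apply strictMonoOn_of_deriv_pos (convex_Icc 0 t)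
    · refine ((continuous_cos.continuousOn.div continuous_sinc.continuousOn hsinc).sub
        continuousOn_const).sub (ContinuousOn.log (by fun_prop) fun x hx => ?_)
      have := hcos x hx
      positivity
    intro x hx
    rw [interior_Icc] at hx
    have hc := hcos x (Set.Ioo_subset_Icc_self hx)
    have hs := hsin x (Set.Ioo_subset_Ioc_self hx)
    have hd : HasDerivAt (fun x => x * cos x / sin x - 1 - log ((1 + 2 * cos x) / 3))
        ((sin x * (cos x + 2) / (1 + 2 * cos x) - x) / sin x ^ 2) x := by
      refine (((((hasDerivAt_id x).mul (hasDerivAt_cos x)).div (hasDerivAt_sin x) hs.ne').sub_const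
        1).sub (((((hasDerivAt_cos x).const_mul 2).const_add 1).div_const 3).log
        (by positivity))).congr_deriv ?_
      simp only [Pi.mul_apply, id]
      have h2 : sin x ^ 2 = 1 - cos x ^ 2 := by linarith [sin_sq_add_cos_sq x]
      field_simp
      grind
    have heq : (fun x => cos x / sinc x - 1 - log ((1 + 2 * cos x) / 3)) =ᶠ[nhds x]
        (fun x => x * cos x / sin x - 1 - log ((1 + 2 * cos x) / 3)) := by
      filter_upwards [eventually_ne_nhds hx.1.ne'] with y hy
      rw [sinc_of_ne_zero hy, div_div_eq_mul_div, mul_comm (cos y)]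
    rw [heq.deriv_eq, hd.deriv]
    have := lt_sin_mul_cos_add_two_div hx.1 (hx.2.trans h1)
    exact div_pos (by linarith) (by positivity)
  have h := hmono (Set.left_mem_Icc.2 h0.le) (Set.right_mem_Icc.2 h0.le) h0
  simp only [cos_zero, sinc_zero, sinc_of_ne_zero h0.ne'] at h
  norm_num [div_div_eq_mul_div] at h
  rw [mul_comm t]
  linarith

lemma two_mul_Gm_add_Am_div_three_lt_Xm {a b : ℝ} (hb : 0 < b) (hab : b < a) :
    (2 * Gm a b + Am a b) / 3 < Xm a b := by
  have ha : 0 < a := hb.trans hab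
  have hs0 : 0 < (a - b) / (a + b) := div_pos (sub_pos.2 hab) (by positivity)
  have hs1 : (a - b) / (a + b) < 1 := by rw [div_lt_one (by positivity)]; linarith
  set t := arcsin ((a - b) / (a + b)) with ht
  have hsin : sin t = (a - b) / (a + b) := sin_arcsin (by linarith) hs1.le
  have hcos : cos t = Gm a b / Am a b := by
    rw [ht, cos_arcsin, Gm, Am,
      show 1 - ((a - b) / (a + b)) ^ 2 = a * b / ((a + b) / 2) ^ 2 by field_simp; ring,
      sqrt_div (by positivity), sqrt_sq (by positivity)]
  have h0 : 0 < t := arcsin_pos.2 hs0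
  have h1 : t < π / 2 := arcsin_lt_pi_div_two.2 hs1
  have hA : 0 < Am a b := by unfold Am; positivity
  have hc : 0 < cos t := cos_pos_of_mem_Ioo ⟨by linarith [pi_pos], h1⟩
  have hGP : Gm a b / Pm a b = t * cos t / sin t := by
    have hne : a - b ≠ 0 := (sub_pos.2 hab).ne'
    rw [hsin, hcos, Pm, ← ht, Am]
    field_simp
  have h := (log_lt_iff_lt_exp (by positivity)).1 (log_one_add_two_cos_lt h0 h1)
  calc (2 * Gm a b + Am a b) / 3 = Am a b * ((1 + 2 * cos t) / 3) := by
        rw [hcos]; field_simp; ring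
    _ < Am a b * exp (t * cos t / sin t - 1) := mul_lt_mul_of_pos_left h hA
    _ = Xm a b := by rw [Xm, hGP]

lemma Am_comm (a b : ℝ) : Am a b = Am b a := by rw [Am, Am, add_comm]

lemma Gm_comm (a b : ℝ) : Gm a b = Gm b a := by rw [Gm, Gm, mul_comm]

lemma Pm_comm (a b : ℝ) : Pm a b = Pm b a := by
  rw [Pm, Pm, ← neg_sub b a, neg_div (a + b) (b - a), arcsin_neg, mul_neg, neg_div_neg_eq,
    add_comm]

lemma Xm_comm (a b : ℝ) : Xm a b = Xm b a := by
  rw [Xm, Xm, Am_comm, Gm_comm, Pm_comm]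

theorem stmt_6 (a b : ℝ) (ha : 0 < a) (hb : 0 < b) (hab : a ≠ b)
    (p : ℝ) (hp : p ≤ 1 / 3) :
    Mp p a b ≤ Mp (1 / 3) a b ∧
    Mp (1 / 3) a b < (2 * Gm a b + Am a b) / 3 ∧
    (2 * Gm a b + Am a b) / 3 < Xm a b := by
  refine ⟨Mp_le_Mp_of_pos_right ha hb (by norm_num) hp, Mp_one_third_lt ha hb hab, ?_⟩
  rcases hab.lt_or_gt with h | h
  · rw [Gm_comm, Am_comm, Xm_comm]
    exact two_mul_Gm_add_Am_div_three_lt_Xm ha h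
  · exact two_mul_Gm_add_Am_div_three_lt_Xm hb h
end
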